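/- arXiv:1609.00317 — 2 statements merged into one kernel-verified Lean document; each statement's English description precedes it below -/
import Mathlib

section
/- Let γ̄ > 0, κ > 0 and let μ, m be positive integers with m ≥ μ. Set Δ₂ = ((μκ+m)/m)·γ̄/(μ(1+κ)) and B_j = C(m−μ, j) · (m/(μκ+m))^j · (μκ/(μκ+m))^{m−μ−j}. Let 0 ≤ a < b ≤ ∞ and let h : ℝ → ℝ be such that x ↦ h(x)·f_S(x) is integrable on (a, b). Then the average of h over the κ-μ shadowed distribution decomposes as ∫ₐᵇ h(x) f_S(x) dx = Σ_{j=0}^{m−μ} B_j · ∫ₐᵇ h(x) · x^{m−j−1} e^{−x/Δ₂} / ((m−j−1)! Δ₂^{m−j}) dx. -/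
open Real MeasureTheory Finset

/-- Rising factorial (Pochhammer symbol) `(a)ₙ = a(a+1)⋯(a+n−1)`. -/
noncomputable def risingFactorial (a : ℝ) (n : ℕ) : ℝ := ∏ i ∈ Finset.range n, (a + i)

/-- Confluent hypergeometric function `₁F₁(a; b; z) = Σ (a)ₙ/(b)ₙ zⁿ/n!`. -/
noncomputable def hyp1F1 (a b z : ℝ) : ℝ :=
  ∑' n : ℕ, risingFactorial a n / risingFactorial b n * z ^ n / (Nat.factorial n : ℝ)

/-- The κ-μ shadowed density with integer fading parameters μ, m. -/
noncomputable def kmuShadowedPDF (γ κ : ℝ) (μ m : ℕ) (x : ℝ) : ℝ :=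
  ((μ : ℝ) ^ μ * (m : ℝ) ^ m * (1 + κ) ^ μ) /
      ((Nat.factorial (μ - 1) : ℝ) * ((m : ℝ) + μ * κ) ^ m * γ) *
    (x / γ) ^ (μ - 1) * Real.exp (-(μ * (1 + κ) * x / γ)) *
    hyp1F1 m μ ((μ : ℝ) ^ 2 * κ * (1 + κ) * x / (((μ : ℝ) * κ + m) * γ))

theorem risingFactorial_natCast_succ (p n : ℕ) :
    risingFactorial ((p + 1 : ℕ) : ℝ) n = ((p + n).factorial : ℝ) / (p.factorial : ℝ) := by
  have hp : (p.factorial : ℝ) ≠ 0 := by positivity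
  rw [eq_div_iff hp]
  induction n with
  | zero => simp [risingFactorial]
  | succ n ih =>
    unfold risingFactorial at ih ⊢
    rw [Finset.prod_range_succ, mul_right_comm, ih, ← add_assoc, Nat.factorial_succ]
    push_cast
    ring

/-- The Taylor coefficients in Kummer's transformation, as a Vandermonde convolution. -/
theorem risingFactorial_div_eq_sum_antidiagonal (p N n : ℕ) (z : ℝ) :
    risingFactorial ((p + N + 1 : ℕ) : ℝ) n / risingFactorial ((p + 1 : ℕ) : ℝ) n * z ^ n /
        (n.factorial : ℝ) =
      ∑ ij ∈ Finset.HasAntidiagonal.antidiagonal n,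
        ((N.choose ij.1 : ℝ) * (p.factorial / (p + ij.1).factorial) * z ^ ij.1) *
          (z ^ ij.2 / (ij.2.factorial : ℝ)) := by
  have hterm : ∀ ij ∈ Finset.HasAntidiagonal.antidiagonal n,
      ((N.choose ij.1 : ℝ) * (p.factorial / (p + ij.1).factorial) * z ^ ij.1) *
          (z ^ ij.2 / (ij.2.factorial : ℝ)) =
        (p.factorial / (p + n).factorial * z ^ n : ℝ) *
          ((N.choose ij.1 * (p + n).choose ij.2 : ℕ) : ℝ) := by
    rintro ⟨i, j⟩ hij
    obtain rfl : i + j = n := by simpa using hij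
    have hc : ((p + (i + j)).choose j : ℝ) =
        ((p + (i + j)).factorial : ℝ) / (j.factorial * (p + i).factorial) := by
      rw [Nat.cast_choose ℝ (by omega : j ≤ p + (i + j))]
      congr 4
      omega
    push_cast
    rw [hc, pow_add]
    have h₁ : ((p + (i + j)).factorial : ℝ) ≠ 0 := by positivity
    field_simp
  rw [Finset.sum_congr rfl hterm, ← Finset.mul_sum, ← Nat.cast_sum, ← Nat.add_choose_eq,
    risingFactorial_natCast_succ, risingFactorial_natCast_succ,
    Nat.cast_choose ℝ (by omega : n ≤ N + (p + n)),
    show N + (p + n) - n = p + N by omega, show N + (p + n) = p + N + n by omega]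
  field_simp

/-- Kummer's transformation for `₁F₁(p + N + 1; p + 1; z)`, where the series terminates. -/
theorem hyp1F1_natCast_eq_exp_mul_sum (p N : ℕ) (z : ℝ) :
    hyp1F1 ((p + N + 1 : ℕ) : ℝ) ((p + 1 : ℕ) : ℝ) z =
      Real.exp z * ∑ k ∈ Finset.range (N + 1),
        (N.choose k : ℝ) * (p.factorial / (p + k).factorial) * z ^ k := by
  set c : ℕ → ℝ := fun k => (N.choose k : ℝ) * (p.factorial / (p + k).factorial) * z ^ k with hc
  have hzero : ∀ k ∉ Finset.range (N + 1), c k = 0 := by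
    intro k hk
    have : N < k := by simpa using hk
    simp [hc, Nat.choose_eq_zero_of_lt this]
  have hcs : Summable fun k => ‖c k‖ :=
    summable_of_ne_finset_zero (s := Finset.range (N + 1)) fun k hk => by simp [hzero k hk]
  have hes : Summable fun k : ℕ => ‖z ^ k / (k.factorial : ℝ)‖ :=
    NormedSpace.norm_expSeries_div_summable z
  have hexp : Real.exp z = ∑' k : ℕ, z ^ k / (k.factorial : ℝ) := by
    rw [Real.exp_eq_exp_ℝ, NormedSpace.exp_eq_tsum_div]
  rw [← tsum_eq_sum (L := .unconditional ℕ) hzero, hexp, mul_comm,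
    tsum_mul_tsum_eq_tsum_sum_antidiagonal_of_summable_norm hcs hes]
  exact tsum_congr fun n => risingFactorial_div_eq_sum_antidiagonal p N n z

/-- For `μ ≤ m` the κ-μ shadowed density is a binomial mixture of gamma densities. -/
theorem kmuShadowedPDF_eq_sum (γ κ : ℝ) (hγ : 0 < γ) (hκ : 0 < κ)
    (μ m : ℕ) (hμ : 0 < μ) (hmμ : μ ≤ m) (Δ : ℝ)
    (hΔ : Δ = ((μ * κ + m) / m) * (γ / (μ * (1 + κ)))) (x : ℝ) :
    kmuShadowedPDF γ κ μ m x =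
      ∑ j ∈ Finset.range (m - μ + 1),
        ((Nat.choose (m - μ) j : ℝ) * ((m : ℝ) / (μ * κ + m)) ^ j *
          ((μ : ℝ) * κ / (μ * κ + m)) ^ (m - μ - j)) *
        (x ^ (m - j - 1) * Real.exp (-x / Δ) /
          ((Nat.factorial (m - j - 1) : ℝ) * Δ ^ (m - j))) := by
  obtain ⟨p, rfl⟩ : ∃ p, μ = p + 1 := ⟨μ - 1, by omega⟩
  obtain ⟨N, rfl⟩ : ∃ N, m = p + N + 1 := ⟨m - (p + 1), by omega⟩
  have hN : p + N + 1 - (p + 1) = N := by omega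
  rw [hN, ← Finset.sum_range_reflect, kmuShadowedPDF, hyp1F1_natCast_eq_exp_mul_sum]
  have hu : (0 : ℝ) < ((p + 1 : ℕ) : ℝ) := by positivity
  have hv : (0 : ℝ) < ((p + N + 1 : ℕ) : ℝ) := by positivity
  generalize ((p + 1 : ℕ) : ℝ) = u at *
  generalize ((p + N + 1 : ℕ) : ℝ) = v at *
  have hD : 0 < u * κ + v := by positivity
  have hκ1 : 0 < 1 + κ := by positivity
  have hexp : Real.exp (-x / Δ) = Real.exp (-(u * (1 + κ) * x / γ)) *
      Real.exp (u ^ 2 * κ * (1 + κ) * x / ((u * κ + v) * γ)) := by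
    rw [← Real.exp_add, hΔ]
    congr 1
    field_simp
    ring
  rw [hexp, Finset.mul_sum, Finset.mul_sum]
  refine Finset.sum_congr rfl fun k hk => ?_
  obtain ⟨j, rfl⟩ : ∃ j, N = k + j := ⟨N - k, by simp at hk; omega⟩
  rw [show k + j + 1 - 1 - k = j by omega, show p + (k + j) + 1 - j - 1 = p + k by omega,
    show p + (k + j) + 1 - j = p + k + 1 by omega, show k + j - j = k by omega,
    show p + 1 - 1 = p by omega, Nat.choose_symm_add, add_comm v (u * κ), hΔ]
  generalize Real.exp (-(u * (1 + κ) * x / γ)) = E₁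
  generalize Real.exp (u ^ 2 * κ * (1 + κ) * x / ((u * κ + v) * γ)) = E₂
  generalize u * κ + v = D at *
  generalize 1 + κ = K at *
  simp only [div_pow, mul_pow, pow_add, pow_one]
  field_simp
  ring

/-- If `h` is integrable against a finite mixture of nonnegative functions with positive weights,
then it is integrable against each component. -/
theorem integrableOn_mul_component_of_sum {ι : Type*} {t : Finset ι} {S : Set ℝ}
    (hS : MeasurableSet S) {w : ι → ℝ} {g : ι → ℝ → ℝ} (hw : ∀ i ∈ t, 0 < w i)
    (hg : ∀ i ∈ t, ∀ x ∈ S, 0 < g i x) (hgm : ∀ i ∈ t, Measurable (g i)) {h : ℝ → ℝ}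
    (hint : IntegrableOn (fun x => h x * ∑ i ∈ t, w i * g i x) S) {i : ι} (hi : i ∈ t) :
    IntegrableOn (fun x => h x * g i x) S := by
  have hle : ∀ x ∈ S, w i * g i x ≤ ∑ i ∈ t, w i * g i x := fun x hx =>
    Finset.single_le_sum (f := fun i => w i * g i x)
      (fun k hk => (mul_pos (hw k hk) (hg k hk x hx)).le) hi
  have hpos : ∀ x ∈ S, 0 < ∑ i ∈ t, w i * g i x := fun x hx =>
    (mul_pos (hw i hi) (hg i hi x hx)).trans_le (hle x hx)
  have hm : Measurable fun x => g i x / ∑ i ∈ t, w i * g i x :=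
    (hgm i hi).div (Finset.measurable_fun_sum t fun k hk => (hgm k hk).const_mul (w k))
  have hbd : ∀ᵐ x ∂volume.restrict S, ‖g i x / ∑ i ∈ t, w i * g i x‖ ≤ (w i)⁻¹ := by
    filter_upwards [ae_restrict_mem hS] with x hx
    rw [Real.norm_of_nonneg (div_nonneg (hg i hi x hx).le (hpos x hx).le), div_le_iff₀ (hpos x hx),
      inv_mul_eq_div, le_div_iff₀ (hw i hi), mul_comm]
    exact hle x hx
  refine IntegrableOn.congr_fun (Integrable.mul_bdd hint hm.aestronglyMeasurable hbd)
    (fun x hx => ?_) hS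
  have := (hpos x hx).ne'
  field_simp

theorem kmuShadowed_average_metric_of_ge (γ κ : ℝ) (hγ : 0 < γ) (hκ : 0 < κ)
    (μ m : ℕ) (hμ : 0 < μ) (hm : 0 < m) (hmμ : μ ≤ m) (Δ₂ : ℝ)
    (hΔ₂ : Δ₂ = ((μ * κ + m) / m) * (γ / (μ * (1 + κ))))
    (B : ℕ → ℝ)
    (hB : ∀ j, B j = (Nat.choose (m - μ) j : ℝ) * ((m : ℝ) / (μ * κ + m)) ^ j *
      ((μ : ℝ) * κ / (μ * κ + m)) ^ (m - μ - j))
    (a : ℝ) (b : EReal) (ha : 0 ≤ a) (hab : (a : EReal) < b)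
    (S : Set ℝ) (hS : S = {x : ℝ | a < x ∧ (x : EReal) < b})
    (h : ℝ → ℝ)
    (hint : MeasureTheory.IntegrableOn (fun x => h x * kmuShadowedPDF γ κ μ m x) S) :
    ∫ x in S, h x * kmuShadowedPDF γ κ μ m x =
      ∑ j ∈ Finset.range (m - μ + 1),
        B j * ∫ x in S, h x * (x ^ (m - j - 1) * Real.exp (-x / Δ₂) /
          ((Nat.factorial (m - j - 1) : ℝ) * Δ₂ ^ (m - j))) := by
  have hSm : MeasurableSet S := by
    rw [hS]
    exact measurableSet_Ioi.inter (measurableSet_lt measurable_coe_real_ereal measurable_const)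
  have hΔpos : 0 < Δ₂ := by
    rw [hΔ₂]
    positivity
  set g : ℕ → ℝ → ℝ := fun j x => x ^ (m - j - 1) * Real.exp (-x / Δ₂) /
    ((Nat.factorial (m - j - 1) : ℝ) * Δ₂ ^ (m - j)) with hg
  have hpdf : ∀ x, kmuShadowedPDF γ κ μ m x =
      ∑ j ∈ Finset.range (m - μ + 1), B j * g j x := fun x => by
    simp only [hB, hg]
    exact kmuShadowedPDF_eq_sum γ κ hγ hκ μ m hμ hmμ Δ₂ hΔ₂ x
  simp only [hpdf] at hint ⊢
  have hBpos : ∀ j ∈ Finset.range (m - μ + 1), 0 < B j := fun j hj => by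
    have : 0 < (m - μ).choose j := Nat.choose_pos (by simpa [Nat.lt_succ_iff] using hj)
    rw [hB]
    positivity
  have hgpos : ∀ j ∈ Finset.range (m - μ + 1), ∀ x ∈ S, 0 < g j x := fun j _ x hx => by
    rw [hS] at hx
    have : 0 < x := ha.trans_lt hx.1
    simp only [hg]
    positivity
  have hgm : ∀ j ∈ Finset.range (m - μ + 1), Measurable (g j) := fun j _ => by
    simp only [hg]
    fun_prop
  have hgi : ∀ j ∈ Finset.range (m - μ + 1), IntegrableOn (fun x => h x * g j x) S :=
    fun j hj => integrableOn_mul_component_of_sum hSm hBpos hgpos hgm hint hj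
  simp only [Finset.mul_sum, mul_left_comm (h _)]
  rw [integral_finsetSum _ fun j hj => (hgi j hj).const_mul (B j)]
  simp only [integral_const_mul, hg]
end

section
/- Let γ̄ > 0, κ > 0 and let μ, m be positive integers with m ≥ μ. Set Δ₂ = ((μκ+m)/m)·γ̄/(μ(1+κ)) and B_j = C(m−μ, j) · (m/(μκ+m))^j · (μκ/(μκ+m))^{m−μ−j}. Then the average channel capacity in κ-μ shadowed fading satisfies ∫₀^∞ log₂(1+x) f_S(x) dx = log₂(e) · Σ_{j=0}^{m−μ} B_j · e^{1/Δ₂} · Σ_{k=0}^{m−j−1} Δ₂^{−k} · Γ(−k, 1/Δ₂), where Γ(−k, z) = ∫_z^∞ t^{−k−1} e^{−t} dt is the upper incomplete gamma function. -/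
open Real MeasureTheory Finset

/-- Upper incomplete gamma function `Γ(−k, z) = ∫_z^∞ t^{−k−1} e^{−t} dt` at negative
integer first argument. -/
noncomputable def upperGammaNegInt (k : ℕ) (z : ℝ) : ℝ :=
  ∫ t in Set.Ioi z, t ^ (-(k : ℤ) - 1) * Real.exp (-t)

open Filter Topology

lemma risingFactorial_succ_left (a : ℝ) (n : ℕ) :
    risingFactorial a (n + 1) = a * risingFactorial (a + 1) n := by
  simp only [risingFactorial, prod_range_succ']
  rw [mul_comm]
  congr 1
  · simp
  · refine prod_congr rfl fun i _ => ?_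
    push_cast
    ring

lemma risingFactorial_succ_right (a : ℝ) (n : ℕ) :
    risingFactorial a (n + 1) = risingFactorial a n * (a + n) := by
  simp only [risingFactorial, prod_range_succ]

lemma risingFactorial_pos {a : ℝ} (ha : 0 < a) (n : ℕ) : 0 < risingFactorial a n :=
  prod_pos fun i _ => by positivity

/-- The coefficient identity behind `₁F₁(a+1; b; z) = ₁F₁(a; b; z) + (z/b) ₁F₁(a+1; b+1; z)`. -/
lemma hyp1F1_coeff_contiguous {a b : ℝ} (hb : 0 < b) (z : ℝ) (n : ℕ) :
    risingFactorial (a + 1) (n + 1) / risingFactorial b (n + 1) * z ^ (n + 1) /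
        (Nat.factorial (n + 1) : ℝ) -
      risingFactorial a (n + 1) / risingFactorial b (n + 1) * z ^ (n + 1) /
        (Nat.factorial (n + 1) : ℝ) =
    z / b * (risingFactorial (a + 1) n / risingFactorial (b + 1) n * z ^ n /
      (Nat.factorial n : ℝ)) := by
  have h := (risingFactorial_pos (by linarith : 0 < b + 1) n).ne'
  rw [risingFactorial_succ_right (a + 1), risingFactorial_succ_left a,
    risingFactorial_succ_left b, Nat.factorial_succ]
  have hn : ((n.factorial : ℕ) : ℝ) ≠ 0 := by positivity
  push_cast
  field_simp
  ring

/-- Contiguous relation for the polynomials `Σ_i C(N,i) z^i / (b)_i`. -/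
lemma sum_choose_div_risingFactorial_succ {b : ℝ} (hb : 0 < b) (z : ℝ) (N : ℕ) :
    ∑ i ∈ range (N + 2), (Nat.choose (N + 1) i : ℝ) * z ^ i / risingFactorial b i =
      ∑ i ∈ range (N + 1), (Nat.choose N i : ℝ) * z ^ i / risingFactorial b i +
        z / b * ∑ i ∈ range (N + 1),
          (Nat.choose N i : ℝ) * z ^ i / risingFactorial (b + 1) i := by
  have hext : ∑ i ∈ range (N + 1), (Nat.choose N i : ℝ) * z ^ i / risingFactorial b i =
      ∑ i ∈ range (N + 2), (Nat.choose N i : ℝ) * z ^ i / risingFactorial b i := by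
    rw [sum_range_succ _ (N + 1)]
    simp
  rw [hext, sum_range_succ', sum_range_succ' _ (N + 1), mul_sum, add_right_comm, ← sum_add_distrib]
  congr 1
  · refine sum_congr rfl fun i _ => ?_
    have h := (risingFactorial_pos (by linarith : 0 < b + 1) i).ne'
    rw [risingFactorial_succ_left b, Nat.choose_succ_succ]
    push_cast
    field_simp
    ring
  · simp

/-- Kummer's transformation in the terminating case. -/
lemma hasSum_hyp1F1_add_nat (z : ℝ) (N : ℕ) {b : ℝ} (hb : 0 < b) :
    HasSum (fun n : ℕ => risingFactorial (b + N) n / risingFactorial b n * z ^ n /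
        (Nat.factorial n : ℝ))
      (exp z * ∑ i ∈ range (N + 1), (Nat.choose N i : ℝ) * z ^ i / risingFactorial b i) := by
  induction N generalizing b with
  | zero =>
    have h := NormedSpace.expSeries_div_hasSum_exp z
    rw [← Real.exp_eq_exp_ℝ] at h
    convert! h using 1
    · funext n
      simp [(risingFactorial_pos hb n).ne']
    · simp [risingFactorial]
  | succ N ih =>
    have h0 := ih hb
    have h1 := (ih (by linarith : 0 < b + 1)).mul_left (z / b)
    have h2 := (hasSum_nat_add_iff' 1).2 h0
    have h3 := h2.add h1
    rw [sum_choose_div_risingFactorial_succ hb, ← hasSum_nat_add_iff' 1]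
    convert! h3 using 1
    · funext n
      have h := hyp1F1_coeff_contiguous (a := b + N) hb z n
      push_cast
      rw [show b + 1 + (N : ℝ) = b + N + 1 by ring, ← h,
        show b + ((N : ℝ) + 1) = b + N + 1 by ring]
      ring
    · simp [risingFactorial]
      ring

lemma hyp1F1_add_nat (z : ℝ) (N : ℕ) {b : ℝ} (hb : 0 < b) :
    hyp1F1 (b + N) b z =
      exp z * ∑ i ∈ range (N + 1), (Nat.choose N i : ℝ) * z ^ i / risingFactorial b i :=
  (hasSum_hyp1F1_add_nat z N hb).tsum_eq

lemma factorial_mul_risingFactorial (k i : ℕ) :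
    (k.factorial : ℝ) * risingFactorial ((k + 1 : ℕ) : ℝ) i = ((k + i).factorial : ℝ) := by
  induction i with
  | zero => simp [risingFactorial]
  | succ i ih =>
    rw [risingFactorial_succ_right, ← mul_assoc, ih, ← add_assoc, Nat.factorial_succ]
    push_cast
    ring

section Integrals

variable {z : ℝ}

lemma integrableOn_pow_mul_exp_neg (hz : 0 < z) (n : ℕ) :
    IntegrableOn (fun x : ℝ => x ^ n * exp (-(z * x))) (Set.Ioi 0) := by
  have h := integrableOn_rpow_mul_exp_neg_mul_rpow (s := n) (p := 1) (b := z)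
    (by have : (0 : ℝ) ≤ n := n.cast_nonneg
        linarith) one_pos hz
  simpa using h

lemma integral_pow_mul_exp_neg (hz : 0 < z) (n : ℕ) :
    ∫ x in Set.Ioi (0 : ℝ), x ^ n * exp (-(z * x)) = n.factorial / z ^ (n + 1) := by
  have h := Real.integral_rpow_mul_exp_neg_mul_Ioi (a := (n : ℝ) + 1) (r := z)
    (by positivity) hz
  rw [Real.Gamma_nat_eq_factorial] at h
  simp only [add_sub_cancel_right, Real.rpow_natCast] at h
  rw [h]
  norm_cast
  rw [one_div, inv_pow]
  field_simp

lemma tendsto_pow_mul_exp_neg (hz : 0 < z) (n : ℕ) :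
    Tendsto (fun x : ℝ => x ^ n * exp (-(z * x))) atTop (𝓝 0) := by
  simpa using tendsto_rpow_mul_exp_neg_mul_atTop_nhds_zero n z hz

lemma integrableOn_pow_mul_exp_neg_div (hz : 0 < z) (n : ℕ) :
    IntegrableOn (fun x : ℝ => x ^ n * exp (-(z * x)) / (1 + x)) (Set.Ioi 0) := by
  refine (integrableOn_pow_mul_exp_neg hz n).mono'
    (Measurable.aestronglyMeasurable (by fun_prop)) ?_
  filter_upwards [ae_restrict_mem measurableSet_Ioi] with x hx
  have hx : 0 < x := hx
  rw [Real.norm_of_nonneg (by positivity)]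
  exact div_le_self (by positivity) (by linarith)

lemma log_one_add_le {x : ℝ} (hx : 0 ≤ x) : log (1 + x) ≤ x := by
  have := Real.log_le_sub_one_of_pos (by linarith : 0 < 1 + x)
  linarith

lemma integrableOn_log_mul_pow_mul_exp_neg (hz : 0 < z) (n : ℕ) :
    IntegrableOn (fun x : ℝ => log (1 + x) * (x ^ n * exp (-(z * x)))) (Set.Ioi 0) := by
  refine (integrableOn_pow_mul_exp_neg hz (n + 1)).mono'
    (by fun_prop) ?_
  filter_upwards [ae_restrict_mem measurableSet_Ioi] with x hx
  have hx : 0 < x := hx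
  rw [Real.norm_of_nonneg (mul_nonneg (log_nonneg (by linarith)) (by positivity)), pow_succ',
    mul_assoc]
  exact mul_le_mul_of_nonneg_right (log_one_add_le hx.le) (by positivity)

lemma tendsto_log_mul_pow_mul_exp_neg (hz : 0 < z) (n : ℕ) :
    Tendsto (fun x : ℝ => log (1 + x) * (x ^ n * exp (-(z * x)))) atTop (𝓝 0) := by
  refine tendsto_of_tendsto_of_tendsto_of_le_of_le' tendsto_const_nhds
    (tendsto_pow_mul_exp_neg hz (n + 1)) ?_ ?_
  · filter_upwards [eventually_ge_atTop 0] with x hx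
    exact mul_nonneg (log_nonneg (by linarith)) (by positivity)
  · filter_upwards [eventually_ge_atTop 0] with x hx
    rw [pow_succ', mul_assoc]
    exact mul_le_mul_of_nonneg_right (log_one_add_le hx) (by positivity)

lemma hasDerivAt_exp_neg_mul (z x : ℝ) :
    HasDerivAt (fun x : ℝ => exp (-(z * x))) (-z * exp (-(z * x))) x := by
  have h := ((hasDerivAt_id x).const_mul z).neg.exp
  simpa [mul_comm] using h

lemma hasDerivAt_log_one_add {x : ℝ} (hx : 0 ≤ x) :
    HasDerivAt (fun x : ℝ => log (1 + x)) (1 / (1 + x)) x :=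
  ((hasDerivAt_id x).const_add 1).log (by simp; linarith)

lemma integral_log_mul_exp_neg (hz : 0 < z) :
    z * ∫ x in Set.Ioi (0 : ℝ), log (1 + x) * (x ^ 0 * exp (-(z * x))) =
      ∫ x in Set.Ioi (0 : ℝ), x ^ 0 * exp (-(z * x)) / (1 + x) := by
  have hJ := integrableOn_pow_mul_exp_neg_div hz 0
  have hL := (integrableOn_log_mul_pow_mul_exp_neg hz 0).const_mul z
  have key := integral_Ioi_of_hasDerivAt_of_tendsto' (a := 0)
    (f := fun x : ℝ => log (1 + x) * (x ^ 0 * exp (-(z * x))))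
    (f' := fun x : ℝ => x ^ 0 * exp (-(z * x)) / (1 + x) -
      z * (log (1 + x) * (x ^ 0 * exp (-(z * x)))))
    (fun x hx => by
      have h := (hasDerivAt_log_one_add hx).mul (hasDerivAt_exp_neg_mul z x)
      simp only [pow_zero, one_mul]
      convert! h using 1
      ring)
    (hJ.sub hL) (tendsto_log_mul_pow_mul_exp_neg hz 0)
  rw [integral_sub hJ hL, integral_const_mul] at key
  simp only [add_zero, log_one, zero_mul, sub_zero] at key
  linarith

lemma integral_log_mul_pow_succ_mul_exp_neg (hz : 0 < z) (n : ℕ) :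
    z * ∫ x in Set.Ioi (0 : ℝ), log (1 + x) * (x ^ (n + 1) * exp (-(z * x))) =
      (∫ x in Set.Ioi (0 : ℝ), x ^ (n + 1) * exp (-(z * x)) / (1 + x)) +
        (n + 1) * ∫ x in Set.Ioi (0 : ℝ), log (1 + x) * (x ^ n * exp (-(z * x))) := by
  have hJ := integrableOn_pow_mul_exp_neg_div hz (n + 1)
  have hL := (integrableOn_log_mul_pow_mul_exp_neg hz (n + 1)).const_mul z
  have hL' := (integrableOn_log_mul_pow_mul_exp_neg hz n).const_mul ((n : ℝ) + 1)
  have hJL : IntegrableOn (fun x : ℝ => x ^ (n + 1) * exp (-(z * x)) / (1 + x) +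
      (n + 1) * (log (1 + x) * (x ^ n * exp (-(z * x))))) (Set.Ioi 0) := hJ.add hL'
  have key := integral_Ioi_of_hasDerivAt_of_tendsto' (a := 0)
    (f := fun x : ℝ => log (1 + x) * (x ^ (n + 1) * exp (-(z * x))))
    (f' := fun x : ℝ => x ^ (n + 1) * exp (-(z * x)) / (1 + x) +
      (n + 1) * (log (1 + x) * (x ^ n * exp (-(z * x)))) -
      z * (log (1 + x) * (x ^ (n + 1) * exp (-(z * x)))))
    (fun x hx => by
      have h := (hasDerivAt_log_one_add hx).mul
        ((hasDerivAt_pow (n + 1) x).mul (hasDerivAt_exp_neg_mul z x))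
      convert! h using 1
      simp only [Pi.mul_apply, Nat.add_sub_cancel]
      push_cast
      ring)
    (hJL.sub hL) (tendsto_log_mul_pow_mul_exp_neg hz (n + 1))
  rw [integral_sub hJL hL, integral_add hJ hL', integral_const_mul,
    integral_const_mul] at key
  simp only [add_zero, log_one, zero_mul, sub_zero] at key
  linarith

lemma integrableOn_zpow_mul_exp_neg (hz : 0 < z) (k : ℕ) :
    IntegrableOn (fun t : ℝ => t ^ (-(k : ℤ) - 1) * exp (-t)) (Set.Ioi z) := by
  refine ((integrableOn_exp_neg_Ioi z).const_mul (z ^ (-(k : ℤ) - 1))).mono'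
    (by fun_prop) ?_
  filter_upwards [ae_restrict_mem measurableSet_Ioi] with t ht
  have ht : z < t := ht
  have ht0 : 0 < t := hz.trans ht
  rw [Real.norm_of_nonneg (by positivity)]
  refine mul_le_mul_of_nonneg_right ?_ (by positivity)
  rw [show -(k : ℤ) - 1 = -((k + 1 : ℕ) : ℤ) by push_cast; ring, zpow_neg, zpow_neg,
    zpow_natCast, zpow_natCast]
  gcongr

lemma upperGammaNegInt_succ (hz : 0 < z) (k : ℕ) :
    (k + 1) * upperGammaNegInt (k + 1) z =
      z ^ (-(k : ℤ) - 1) * exp (-z) - upperGammaNegInt k z := by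
  have h0 := integrableOn_zpow_mul_exp_neg hz k
  have h1 := (integrableOn_zpow_mul_exp_neg hz (k + 1)).const_mul (-((k : ℝ) + 1))
  have key := integral_Ioi_of_hasDerivAt_of_tendsto' (a := z) (m := 0)
    (f := fun t : ℝ => t ^ (-(k : ℤ) - 1) * exp (-t))
    (f' := fun t : ℝ => -((k : ℝ) + 1) * (t ^ (-((k + 1 : ℕ) : ℤ) - 1) * exp (-t)) -
      t ^ (-(k : ℤ) - 1) * exp (-t))
    (fun t ht => by
      have ht0 : t ≠ 0 := (hz.trans_le ht).ne'
      have h := (hasDerivAt_zpow (-(k : ℤ) - 1) t (Or.inl ht0)).mul (hasDerivAt_neg t).exp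
      convert! h using 1
      rw [show -((k + 1 : ℕ) : ℤ) - 1 = -(k : ℤ) - 1 - 1 by push_cast; ring]
      push_cast
      ring)
    (h1.sub h0) (by
      have h := (tendsto_rpow_mul_exp_neg_mul_atTop_nhds_zero ((-(k : ℤ) - 1 : ℤ) : ℝ) 1 one_pos)
      simp only [Real.rpow_intCast] at h
      simpa using h)
  rw [integral_sub h1 h0, integral_const_mul] at key
  simp only [upperGammaNegInt]
  linarith

lemma integral_exp_neg_div_one_add (hz : 0 < z) :
    ∫ x in Set.Ioi (0 : ℝ), x ^ 0 * exp (-(z * x)) / (1 + x) = exp z * upperGammaNegInt 0 z := by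
  have h1 := integral_comp_mul_left_Ioi
    (fun t : ℝ => t ^ (-((0 : ℕ) : ℤ) - 1) * exp (-t)) 1 hz
  have h2 := (measurePreserving_add_left (volume : Measure ℝ) 1).setIntegral_preimage_emb
    (measurableEmbedding_addLeft 1)
    (fun x : ℝ => (z * x) ^ (-((0 : ℕ) : ℤ) - 1) * exp (-(z * x))) (Set.Ioi 1)
  rw [h1, mul_one, Set.preimage_const_add_Ioi, sub_self, smul_eq_mul] at h2
  rw [upperGammaNegInt, ← mul_inv_cancel_left₀ hz.ne' (∫ t in Set.Ioi z, _), ← h2,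
    ← integral_const_mul, ← integral_const_mul]
  refine setIntegral_congr_fun measurableSet_Ioi fun x hx => ?_
  have hx : 0 < x := hx
  have hx' : 1 + x ≠ 0 := by positivity
  have he : exp (-(z * x)) = exp z * exp (-(z * (1 + x))) := by
    rw [← exp_add]
    ring_nf
  simp only [he, Nat.cast_zero, neg_zero, zero_sub, zpow_neg_one, pow_zero]
  field_simp

lemma integral_pow_succ_mul_exp_neg_div (hz : 0 < z) (k : ℕ) :
    ∫ x in Set.Ioi (0 : ℝ), x ^ (k + 1) * exp (-(z * x)) / (1 + x) =
      k.factorial / z ^ (k + 1) - ∫ x in Set.Ioi (0 : ℝ), x ^ k * exp (-(z * x)) / (1 + x) := by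
  rw [← integral_pow_mul_exp_neg hz k, ← integral_sub (integrableOn_pow_mul_exp_neg hz k)
    (integrableOn_pow_mul_exp_neg_div hz k)]
  refine setIntegral_congr_fun measurableSet_Ioi fun x hx => ?_
  have hx : 0 < x := hx
  have hx' : 1 + x ≠ 0 := by positivity
  field_simp
  ring

/-- `∫₀^∞ x^k e^{-zx} / (1+x) dx = k! e^z Γ(-k, z)`. -/
lemma integral_pow_mul_exp_neg_div (hz : 0 < z) (k : ℕ) :
    ∫ x in Set.Ioi (0 : ℝ), x ^ k * exp (-(z * x)) / (1 + x) =
      k.factorial * (exp z * upperGammaNegInt k z) := by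
  induction k with
  | zero => simpa using integral_exp_neg_div_one_add hz
  | succ k ih =>
    have hp : z ^ (-(k : ℤ) - 1) = (z ^ (k + 1))⁻¹ := by
      rw [show -(k : ℤ) - 1 = -((k + 1 : ℕ) : ℤ) by push_cast; ring, zpow_neg, zpow_natCast]
    have hrec := upperGammaNegInt_succ hz k
    have hexp : exp z * exp (-z) = 1 := by rw [← exp_add]; simp
    rw [integral_pow_succ_mul_exp_neg_div hz, ih, Nat.factorial_succ]
    push_cast
    rw [show ((k : ℝ) + 1) * k.factorial * (exp z * upperGammaNegInt (k + 1) z) =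
      k.factorial * exp z * ((k + 1) * upperGammaNegInt (k + 1) z) by ring, hrec, hp]
    linear_combination (-(k.factorial : ℝ) * (z ^ (k + 1))⁻¹) * hexp

/-- The logarithmic moment of a Gamma density with integer shape `n + 1` and rate `z`. -/
lemma integral_log_mul_gamma_density (hz : 0 < z) (n : ℕ) :
    z ^ (n + 1) / n.factorial *
        ∫ x in Set.Ioi (0 : ℝ), log (1 + x) * (x ^ n * exp (-(z * x))) =
      exp z * ∑ k ∈ range (n + 1), z ^ k * upperGammaNegInt k z := by
  induction n with
  | zero =>
    have h := integral_log_mul_exp_neg hz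
    rw [integral_pow_mul_exp_neg_div hz] at h
    simpa using h
  | succ n ih =>
    have h := integral_log_mul_pow_succ_mul_exp_neg hz n
    rw [integral_pow_mul_exp_neg_div hz] at h
    rw [sum_range_succ, mul_add, ← ih, pow_succ z (n + 1), mul_div_right_comm, mul_assoc, h,
      Nat.factorial_succ]
    have hn : ((n.factorial : ℕ) : ℝ) ≠ 0 := by positivity
    generalize ∫ x in Set.Ioi (0 : ℝ), log (1 + x) * (x ^ n * exp (-(z * x))) = I
    push_cast
    field_simp
    ring

end Integrals

/-- For `m ≥ μ`, the κ-μ shadowed density is a finite binomial mixture of Gamma densities. -/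
lemma kmuShadowedPDF_eq_sum_s14 {γ κ : ℝ} (hγ : 0 < γ) (hκ : 0 < κ) (p N : ℕ) {z : ℝ}
    (hz : z = ((p + 1 + N : ℕ) / (((p + 1 : ℕ) : ℝ) * κ + (p + 1 + N : ℕ))) *
      (((p + 1 : ℕ) : ℝ) * (1 + κ) / γ)) (x : ℝ) :
    kmuShadowedPDF γ κ (p + 1) (p + 1 + N) x =
      ∑ i ∈ range (N + 1), (Nat.choose N i : ℝ) *
        (((p + 1 + N : ℕ) : ℝ) / (((p + 1 : ℕ) : ℝ) * κ + (p + 1 + N : ℕ))) ^ (N - i) *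
        (((p + 1 : ℕ) : ℝ) * κ / (((p + 1 : ℕ) : ℝ) * κ + (p + 1 + N : ℕ))) ^ i *
        (z ^ (p + i + 1) / (p + i).factorial * (x ^ (p + i) * exp (-(z * x)))) := by
  have hμ : (0 : ℝ) < ((p + 1 : ℕ) : ℝ) := by positivity
  have hm : (0 : ℝ) < ((p + 1 + N : ℕ) : ℝ) := by positivity
  have hH := fun w => hyp1F1_add_nat w N hμ
  rw [← Nat.cast_add] at hH
  rw [kmuShadowedPDF, hH]
  simp only [← factorial_mul_risingFactorial]
  have hr := fun i => (risingFactorial_pos hμ i).ne'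
  have hpow : ((p + 1 + N : ℕ) : ℝ) ^ (p + 1 + N) =
      ((p + 1 + N : ℕ) : ℝ) ^ (p + 1) * ((p + 1 + N : ℕ) : ℝ) ^ N := pow_add _ _ _
  rw [hpow]
  generalize ((p + 1 : ℕ) : ℝ) = μ at *
  generalize ((p + 1 + N : ℕ) : ℝ) = m at *
  have hs : 0 < μ * κ + m := by positivity
  have hexp : exp (-(z * x)) = exp (-(μ * (1 + κ) * x / γ)) *
      exp (μ ^ 2 * κ * (1 + κ) * x / ((μ * κ + m) * γ)) := by
    rw [← exp_add, hz]
    congr 1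
    field_simp
    ring
  rw [hexp, mul_sum, mul_sum]
  refine sum_congr rfl fun i hi => ?_
  obtain ⟨l, rfl⟩ := Nat.exists_eq_add_of_le (Nat.lt_succ_iff.1 (mem_range.1 hi))
  rw [hz, Nat.add_sub_cancel, Nat.add_sub_cancel_left, add_comm m (μ * κ)]
  have h1 := hr i
  have hp : ((p.factorial : ℕ) : ℝ) ≠ 0 := by positivity
  generalize exp (-(μ * (1 + κ) * x / γ)) = E₁
  generalize exp (μ ^ 2 * κ * (1 + κ) * x / ((μ * κ + m) * γ)) = E₂
  generalize μ * κ + m = s at *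
  simp only [div_pow, mul_pow]
  field_simp
  ring

theorem kmuShadowed_capacity_of_ge (γ κ : ℝ) (hγ : 0 < γ) (hκ : 0 < κ)
    (μ m : ℕ) (hμ : 0 < μ) (hm : 0 < m) (hmμ : μ ≤ m) (Δ₂ : ℝ)
    (hΔ₂ : Δ₂ = ((μ * κ + m) / m) * (γ / (μ * (1 + κ))))
    (B : ℕ → ℝ)
    (hB : ∀ j, B j = (Nat.choose (m - μ) j : ℝ) * ((m : ℝ) / (μ * κ + m)) ^ j *
      ((μ : ℝ) * κ / (μ * κ + m)) ^ (m - μ - j)) :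
    ∫ x in Set.Ioi (0 : ℝ), Real.logb 2 (1 + x) * kmuShadowedPDF γ κ μ m x =
      Real.logb 2 (Real.exp 1) *
        ∑ j ∈ Finset.range (m - μ + 1),
          B j * Real.exp (1 / Δ₂) *
            ∑ k ∈ Finset.range (m - j), Δ₂ ^ (-(k : ℤ)) * upperGammaNegInt k (1 / Δ₂) := by
  obtain ⟨N, rfl⟩ := Nat.exists_eq_add_of_le hmμ
  obtain ⟨p, rfl⟩ := Nat.exists_eq_succ_of_ne_zero hμ.ne'
  simp only [Nat.succ_eq_add_one, Nat.add_sub_cancel_left] at *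
  have hΔ : 0 < Δ₂ := by
    rw [hΔ₂]
    positivity
  have hz : 0 < 1 / Δ₂ := by positivity
  have hzeq : 1 / Δ₂ = ((p + 1 + N : ℕ) / (((p + 1 : ℕ) : ℝ) * κ + (p + 1 + N : ℕ))) *
      (((p + 1 : ℕ) : ℝ) * (1 + κ) / γ) := by
    rw [hΔ₂, one_div, mul_inv, inv_div, inv_div]
  have hzpow : ∀ k : ℕ, Δ₂ ^ (-(k : ℤ)) = (1 / Δ₂) ^ k := fun k => by
    rw [zpow_neg, zpow_natCast, one_div, inv_pow]
  simp only [hzpow]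
  generalize 1 / Δ₂ = z at *
  have hf : ∀ x : ℝ, logb 2 (1 + x) * kmuShadowedPDF γ κ (p + 1) (p + 1 + N) x =
      ∑ i ∈ range (N + 1), logb 2 (exp 1) * B (N - i) * (z ^ (p + i + 1) / (p + i).factorial) *
        (log (1 + x) * (x ^ (p + i) * exp (-(z * x)))) := fun x => by
    rw [kmuShadowedPDF_eq_sum_s14 hγ hκ p N hzeq, mul_sum]
    refine sum_congr rfl fun i hi => ?_
    have hiN : i ≤ N := Nat.lt_succ_iff.1 (mem_range.1 hi)
    rw [hB, Nat.sub_sub_self hiN, Nat.choose_symm hiN, logb, logb, log_exp]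
    ring
  simp only [hf]
  rw [integral_finsetSum _ fun i _ =>
    (integrableOn_log_mul_pow_mul_exp_neg hz (p + i)).const_mul _, mul_sum,
    ← sum_range_reflect (n := N + 1)]
  refine sum_congr rfl fun j hj => ?_
  have hjN : j ≤ N := Nat.lt_succ_iff.1 (mem_range.1 hj)
  rw [integral_const_mul, mul_assoc (_ * _), integral_log_mul_gamma_density hz]
  rw [show N - (N + 1 - 1 - j) = j by omega,
    show p + (N + 1 - 1 - j) + 1 = p + 1 + N - j by omega]
  ring
end
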